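/- Let S ⊆ G_d be such that p(S) is a vertex of the White Whale H_∞^+(d,1). Then the all-ones vector 𝟏 = (1,…,1) belongs to S if and only if |S| ≥ 2^{d−1}. -/

import Mathlib

/-- The set `G_d` of generators of the White Whale:
all nonzero 0/1-valued vectors of `ℝ^d`. -/
def whaleGens (d : ℕ) : Set (Fin d → ℝ) :=
  {g | g ≠ 0 ∧ ∀ i, g i = 0 ∨ g i = 1}

/-- The point `p(S)`: the sum of the vectors in `S` (with `p(∅) = 0`). -/
noncomputable def whaleSum {d : ℕ} (S : Set (Fin d → ℝ)) : Fin d → ℝ :=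
  ∑ᶠ g ∈ S, g

/-- The White Whale `H_∞^+(d,1)`: the convex hull of the points `p(S)`
over all subsets `S ⊆ G_d`. -/
noncomputable def whiteWhale (d : ℕ) : Set (Fin d → ℝ) :=
  convexHull ℝ {x | ∃ S : Set (Fin d → ℝ), S ⊆ whaleGens d ∧ x = whaleSum S}

/-- A vertex of the White Whale is an extreme point of it. -/
def IsWhaleVertex (d : ℕ) (x : Fin d → ℝ) : Prop :=
  x ∈ Set.extremePoints ℝ (whiteWhale d)

/-- The vectors of `ℝ^d` with entries in `{0, 1}`. -/
noncomputable def zeroOneVectors (d : ℕ) : Finset (Fin d → ℝ) :=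
  Fintype.piFinset fun _ => {0, 1}

theorem mem_zeroOneVectors {d : ℕ} {g : Fin d → ℝ} :
    g ∈ zeroOneVectors d ↔ ∀ i, g i = 0 ∨ g i = 1 := by
  simp [zeroOneVectors]

theorem card_zeroOneVectors (d : ℕ) : (zeroOneVectors d).card = 2 ^ d := by
  simp [zeroOneVectors]

theorem one_sub_mem_zeroOneVectors {d : ℕ} {g : Fin d → ℝ} (hg : g ∈ zeroOneVectors d) :
    1 - g ∈ zeroOneVectors d := by
  rw [mem_zeroOneVectors] at hg ⊢
  intro i
  rcases hg i with h | h <;> simp [h]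

theorem mem_whaleGens_iff {d : ℕ} {g : Fin d → ℝ} :
    g ∈ whaleGens d ↔ g ≠ 0 ∧ g ∈ zeroOneVectors d := by
  rw [mem_zeroOneVectors]; rfl

theorem whaleGens_finite (d : ℕ) : (whaleGens d).Finite :=
  (zeroOneVectors d).finite_toSet.subset fun _ hg => (mem_whaleGens_iff.1 hg).2

theorem whaleSum_union {d : ℕ} {S T : Set (Fin d → ℝ)} (h : Disjoint S T)
    (hS : S.Finite) (hT : T.Finite) : whaleSum (S ∪ T) = whaleSum S + whaleSum T :=
  finsum_mem_union h hS hT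

theorem whaleSum_singleton {d : ℕ} (g : Fin d → ℝ) : whaleSum {g} = g :=
  finsum_mem_singleton

theorem whaleSum_pair {d : ℕ} {g h : Fin d → ℝ} (hgh : g ≠ h) : whaleSum {g, h} = g + h :=
  finsum_mem_pair hgh

/-- If `p(S)` is a vertex and `A ⊆ S`, `B ⊆ G_d ∖ S` satisfy `p(A) = p(B)`, then `p(A) = 0`. -/
theorem IsWhaleVertex.whaleSum_eq_zero {d : ℕ} {S A B : Set (Fin d → ℝ)}
    (hS : S ⊆ whaleGens d) (hv : IsWhaleVertex d (whaleSum S)) (hA : A ⊆ S)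
    (hB : B ⊆ whaleGens d) (hSB : Disjoint S B) (hAB : whaleSum A = whaleSum B) :
    whaleSum A = 0 := by
  have hSf := (whaleGens_finite d).subset hS
  have hBf := (whaleGens_finite d).subset hB
  have hunion : whaleSum (S ∪ B) = whaleSum S + whaleSum A := by
    rw [whaleSum_union hSB hSf hBf, hAB]
  have hdiff : whaleSum (S \ A) + whaleSum A = whaleSum S := by
    rw [← whaleSum_union Set.disjoint_sdiff_left (hSf.subset Set.sdiff_subset) (hSf.subset hA),
      Set.sdiff_union_of_subset hA]
  have hmem : ∀ T ⊆ whaleGens d, whaleSum T ∈ whiteWhale d := fun T hT =>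
    subset_convexHull ℝ _ ⟨T, hT, rfl⟩
  have hseg : whaleSum S ∈ openSegment ℝ (whaleSum (S ∪ B)) (whaleSum (S \ A)) := by
    refine ⟨1 / 2, 1 / 2, by norm_num, by norm_num, by norm_num, ?_⟩
    rw [hunion, ← hdiff]
    module
  have heq := hv.2 (hmem _ (Set.union_subset hS hB)) (hmem _ (Set.sdiff_subset.trans hS)) hseg
  rw [hunion] at heq
  simpa using heq

theorem one_ne_zero_of_one_le {d : ℕ} (hd : 1 ≤ d) : (1 : Fin d → ℝ) ≠ 0 := fun h => by
  simpa using congrFun h ⟨0, hd⟩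

theorem one_mem_whaleGens {d : ℕ} (hd : 1 ≤ d) : (1 : Fin d → ℝ) ∈ whaleGens d :=
  ⟨one_ne_zero_of_one_le hd, fun _ => Or.inr rfl⟩

theorem ne_one_sub_of_mem_zeroOneVectors {d : ℕ} (hd : 1 ≤ d) {g : Fin d → ℝ}
    (hg : g ∈ zeroOneVectors d) : g ≠ 1 - g := fun h => by
  have h0 := congrFun h ⟨0, hd⟩
  rcases mem_zeroOneVectors.1 hg ⟨0, hd⟩ with h1 | h1 <;> simp [h1] at h0

theorem whaleSum_pair_one_sub {d : ℕ} (hd : 1 ≤ d) {g : Fin d → ℝ}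
    (hg : g ∈ zeroOneVectors d) : whaleSum {g, 1 - g} = 1 := by
  rw [whaleSum_pair (ne_one_sub_of_mem_zeroOneVectors hd hg), add_sub_cancel]

theorem IsWhaleVertex.mem_or_one_sub_mem {d : ℕ} (hd : 1 ≤ d) {S : Set (Fin d → ℝ)}
    (hS : S ⊆ whaleGens d) (hv : IsWhaleVertex d (whaleSum S)) (h1 : 1 ∈ S)
    {g : Fin d → ℝ} (hg : g ∈ zeroOneVectors d) : g ∈ S ∨ 1 - g ∈ S := by
  by_contra! hcon
  have hg0 : g ≠ 0 := by
    rintro rfl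
    exact hcon.2 (by simpa using h1)
  have hg1 : 1 - g ≠ 0 := fun h => hcon.1 (sub_eq_zero.1 h ▸ h1)
  refine one_ne_zero_of_one_le hd ?_
  rw [← whaleSum_singleton 1]
  refine hv.whaleSum_eq_zero (B := {g, 1 - g}) hS (Set.singleton_subset_iff.2 h1) ?_ ?_ ?_
  · exact Set.pair_subset (mem_whaleGens_iff.2 ⟨hg0, hg⟩)
      (mem_whaleGens_iff.2 ⟨hg1, one_sub_mem_zeroOneVectors hg⟩)
  · simpa using hcon
  · rw [whaleSum_singleton, whaleSum_pair_one_sub hd hg]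

theorem IsWhaleVertex.one_sub_notMem {d : ℕ} (hd : 1 ≤ d) {S : Set (Fin d → ℝ)}
    (hS : S ⊆ whaleGens d) (hv : IsWhaleVertex d (whaleSum S)) (h1 : 1 ∉ S)
    {g : Fin d → ℝ} (hg : g ∈ S) : 1 - g ∉ S := by
  intro hg'
  have hgc := (mem_whaleGens_iff.1 (hS hg)).2
  refine one_ne_zero_of_one_le hd ?_
  rw [← whaleSum_pair_one_sub hd hgc]
  refine hv.whaleSum_eq_zero (B := {1}) hS (Set.pair_subset hg hg')
    (Set.singleton_subset_iff.2 (one_mem_whaleGens hd)) (by simpa using h1) ?_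
  rw [whaleSum_singleton, whaleSum_pair_one_sub hd hgc]

theorem ncard_image_one_sub {d : ℕ} (S : Set (Fin d → ℝ)) :
    ((fun g => 1 - g) '' S).ncard = S.ncard :=
  Set.ncard_image_of_injective S sub_right_injective

/-- If p(S) is a vertex of the White Whale, then the all-ones vector belongs
to S if and only if |S| ≥ 2^(d−1). -/
theorem whale_allOnes_mem_iff (d : ℕ) (hd : 1 ≤ d)
    (S : Set (Fin d → ℝ)) (hS : S ⊆ whaleGens d)
    (hv : IsWhaleVertex d (whaleSum S)) :
    (fun _ : Fin d => (1 : ℝ)) ∈ S ↔ 2 ^ (d - 1) ≤ S.ncard := by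
  change 1 ∈ S ↔ _
  have hSf := (whaleGens_finite d).subset hS
  have hpow : 2 ^ d = 2 * 2 ^ (d - 1) := by
    rw [← pow_succ', Nat.sub_add_cancel hd]
  have hcard : ((zeroOneVectors d : Set (Fin d → ℝ))).ncard = 2 ^ d := by
    rw [Set.ncard_coe_finset, card_zeroOneVectors]
  constructor
  · intro h1
    have hsub : (zeroOneVectors d : Set (Fin d → ℝ)) ⊆ S ∪ (fun g => 1 - g) '' S := by
      intro g hg
      refine (hv.mem_or_one_sub_mem hd hS h1 hg).imp_right fun h => ⟨1 - g, h, ?_⟩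
      simp
    have hle := (Set.ncard_le_ncard hsub (hSf.union (hSf.image _))).trans
      (Set.ncard_union_le _ _)
    rw [ncard_image_one_sub, hcard] at hle
    omega
  · contrapose!
    intro h1
    have hdisj : Disjoint S ((fun g => 1 - g) '' S) := by
      rw [Set.disjoint_left]
      rintro _ hg ⟨h, hh, rfl⟩
      exact hv.one_sub_notMem hd hS h1 hh hg
    have hssub : S ∪ (fun g => 1 - g) '' S ⊂ (zeroOneVectors d : Set (Fin d → ℝ)) := by
      refine (Set.ssubset_iff_of_subset ?_).2
        ⟨0, mem_zeroOneVectors.2 fun _ => Or.inl rfl, ?_⟩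
      · rintro g (hg | ⟨h, hh, rfl⟩)
        · exact (mem_whaleGens_iff.1 (hS hg)).2
        · exact one_sub_mem_zeroOneVectors (mem_whaleGens_iff.1 (hS hh)).2
      · rintro (h0 | ⟨h, hh, h0⟩)
        · exact (hS h0).1 rfl
        · exact h1 (sub_eq_zero.1 h0 ▸ hh)
    have hlt := Set.ncard_lt_ncard hssub (zeroOneVectors d).finite_toSet
    rw [Set.ncard_union_eq hdisj hSf (hSf.image _), ncard_image_one_sub, hcard] at hlt
    omega
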